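/- Let N ≥ 3 and let Ω ⊂ ℝ^N be a smooth bounded domain containing the origin. Then there exists a constant K₁ > 0 such that for every nonnegative u ∈ C₀^∞(Ω) and every ε > 0, ∫_Ω u(x)² · ( −log d(x) ) dx ≤ ε · ∫_Ω ( |∇u|² − ((N−2)²/(4|x|²)) u² ) dx + ( K₁ − (1/2) · log ε ) · ‖u‖₂², where ‖u‖₂ := (∫_Ω u² dx)^{1/2}. -/

import Mathlib

open MeasureTheory Real

noncomputable section

/-- A set `Ω ⊆ ℝ^N` is a C² domain: it is the sublevel set of a C² function whose
differential does not vanish on the boundary. -/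
def IsC2Domain {N : ℕ} (Ω : Set (EuclideanSpace ℝ (Fin N))) : Prop :=
  ∃ φ : EuclideanSpace ℝ (Fin N) → ℝ,
    ContDiff ℝ 2 φ ∧ Ω = {x | φ x < 0} ∧ ∀ x ∈ frontier Ω, fderiv ℝ φ x ≠ 0

/-- Distance to the boundary of `Ω`. -/
def bdist {N : ℕ} (Ω : Set (EuclideanSpace ℝ (Fin N))) (x : EuclideanSpace ℝ (Fin N)) : ℝ :=
  Metric.infDist x (frontier Ω)


abbrev EE (N : ℕ) := EuclideanSpace ℝ (Fin N)

lemma intOn_aux {N : ℕ} {Ω : Set (EE N)} (hΩ : IsOpen Ω) {u : EE N → ℝ} (hc : HasCompactSupport u)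
    (hs : tsupport u ⊆ Ω) {f : EE N → ℝ} (hf : ContinuousOn f Ω)
    (h0 : ∀ x, x ∉ tsupport u → f x = 0) : IntegrableOn f Ω := by
  have h1 : IntegrableOn f (tsupport u) := (hf.mono hs).integrableOn_compact hc
  exact h1.of_forall_sdiff_eq_zero hΩ.measurableSet (fun x hx => h0 x hx.2)

lemma int_deriv_zero {N : ℕ} {V : EE N → ℝ} (hV : ContDiff ℝ 1 V) (hc : HasCompactSupport V)
    (v : EE N) : Integrable (fun x => fderiv ℝ V x v) ∧ ∫ x, fderiv ℝ V x v = 0 := by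
  have hi : Integrable (fun x => fderiv ℝ V x v) := by
    apply Continuous.integrable_of_hasCompactSupport
    · exact (hV.continuous_fderiv one_ne_zero).clm_apply continuous_const
    · exact (hc.fderiv_apply (𝕜 := ℝ) v)
  refine ⟨hi, ?_⟩
  have := integral_mul_fderiv_eq_neg_fderiv_mul_of_integrable (μ := volume) (f := fun _ : EE N => (1:ℝ)) (g := V) (v := v)
    (by simp) (by simpa using hi) (by simpa using hV.continuous.integrable_of_hasCompactSupport hc)
    (by fun_prop) (fun x _ => hV.differentiable one_ne_zero x)
  simpa using this

/-- divergence of a vector field -/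
def dvg {N : ℕ} (F : EE N → EE N) (x : EE N) : ℝ :=
  ∑ i, (fderiv ℝ F x (EuclideanSpace.single i 1)) i

lemma fderiv_coord {N : ℕ} {F : EE N → EE N} {x : EE N} (hF : DifferentiableAt ℝ F x)
    (i : Fin N) (v : EE N) : fderiv ℝ (fun y => F y i) x v = (fderiv ℝ F x v) i := by
  have h : HasFDerivAt (fun y => F y i) ((EuclideanSpace.proj (𝕜 := ℝ) i).comp (fderiv ℝ F x)) x :=
    (EuclideanSpace.proj i : EE N →L[ℝ] ℝ).hasFDerivAt.comp x hF.hasFDerivAt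
  rw [h.fderiv]; rfl

lemma dvg_add {N : ℕ} {F G : EE N → EE N} {x : EE N} (hF : DifferentiableAt ℝ F x)
    (hG : DifferentiableAt ℝ G x) : dvg (fun y => F y + G y) x = dvg F x + dvg G x := by
  unfold dvg
  rw [fderiv_fun_add hF hG, ← Finset.sum_add_distrib]
  simp

lemma dvg_id {N : ℕ} (x : EE N) : dvg (fun y => y) x = N := by
  unfold dvg
  simp

lemma sum_single {N : ℕ} (v : EE N) : ∑ i, v i • (EuclideanSpace.single i (1:ℝ) : EE N) = v := by
  simpa using (EuclideanSpace.basisFun (Fin N) ℝ).sum_repr v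

lemma dvg_smul {N : ℕ} {f : EE N → ℝ} {F : EE N → EE N} {x : EE N} (hf : DifferentiableAt ℝ f x)
    (hF : DifferentiableAt ℝ F x) :
    dvg (fun y => f y • F y) x = fderiv ℝ f x (F x) + f x * dvg F x := by
  unfold dvg
  rw [fderiv_fun_smul hf hF]
  conv_rhs => rw [← sum_single (F x)]
  rw [map_sum, Finset.mul_sum, ← Finset.sum_add_distrib]
  refine Finset.sum_congr rfl fun i _ => ?_
  simp
  ring

lemma dvg_cont {N : ℕ} {Ω : Set (EE N)} (hΩ : IsOpen Ω) {F : EE N → EE N}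
    (hF : ContDiffOn ℝ 1 F Ω) : ContinuousOn (dvg F) Ω := by
  unfold dvg
  have h := hF.continuousOn_fderiv_of_isOpen hΩ le_rfl
  refine continuousOn_finsetSum _ fun i _ => ?_
  exact (EuclideanSpace.proj i : EE N →L[ℝ] ℝ).continuous.comp_continuousOn
    (h.clm_apply continuousOn_const)

lemma grad_cont {N : ℕ} {u : EE N → ℝ} (hu : ContDiff ℝ 1 u) : Continuous (gradient u) := by
  unfold gradient
  exact (InnerProductSpace.toDual ℝ (EE N)).symm.continuous.comp (hu.continuous_fderiv one_ne_zero)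

lemma vf_ineq {N : ℕ} {Ω : Set (EE N)} (hΩ : IsOpen Ω) {u : EE N → ℝ} (hu : ContDiff ℝ 1 u)
    (hc : HasCompactSupport u) (hs : tsupport u ⊆ Ω) {F : EE N → EE N}
    (hF : ContDiffOn ℝ 1 F Ω) :
    ∫ x in Ω, u x ^ 2 * (dvg F x - ‖F x‖ ^ 2) ≤ ∫ x in Ω, ‖gradient u x‖ ^ 2 := by
  set W : EE N → EE N := fun x => (u x ^ 2) • F x with hW
  have hz : ∀ x, x ∉ tsupport u → u x = 0 := fun x hx => image_eq_zero_of_notMem_tsupport hx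
  have hWz : ∀ x, x ∉ tsupport u → W =ᶠ[nhds x] fun _ => 0 := by
    intro x hx
    filter_upwards [(isClosed_tsupport u).isOpen_compl.mem_nhds hx] with y hy
    simp [hW, hz y hy]
  have hWc : ContDiff ℝ 1 W := by
    rw [contDiff_iff_contDiffAt]
    intro x
    by_cases hx : x ∈ tsupport u
    · exact (hu.contDiffAt.pow 2).smul (hF.contDiffAt (hΩ.mem_nhds (hs hx)))
    · exact contDiffAt_const.congr_of_eventuallyEq (hWz x hx)
  have hdz : ∀ x, x ∉ tsupport u → dvg W x = 0 := by
    intro x hx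
    simp [dvg, (hWz x hx).fderiv_eq]
  have hint : ∫ x, dvg W x = 0 := by
    have hi : ∀ i : Fin N, Integrable (fun x => (fderiv ℝ W x (EuclideanSpace.single i 1)) i) ∧
      ∫ x, (fderiv ℝ W x (EuclideanSpace.single i 1)) i = 0 := by
      intro i
      have hV : ContDiff ℝ 1 (fun x => W x i) :=
        (EuclideanSpace.proj i : EE N →L[ℝ] ℝ).contDiff.comp hWc
      have hVc : HasCompactSupport (fun x => W x i) := by
        refine HasCompactSupport.intro hc fun x hx => ?_
        simp [hW, hz x hx]
      have := int_deriv_zero hV hVc (EuclideanSpace.single i 1)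
      simpa only [fderiv_coord (hWc.differentiable one_ne_zero _)] using this
    unfold dvg
    rw [integral_finsetSum _ fun i _ => (hi i).1]
    exact Finset.sum_eq_zero fun i _ => (hi i).2
  have hint2 : ∫ x in Ω, dvg W x = 0 := by
    rw [setIntegral_eq_integral_of_forall_compl_eq_zero, hint]
    exact fun x hx => hdz x fun h => hx (hs h)
  have hWi : IntegrableOn (dvg W) Ω := intOn_aux hΩ hc hs (dvg_cont hΩ hWc.contDiffOn) hdz
  have hgz : ∀ x, x ∉ tsupport u → gradient u x = 0 := by
    intro x hx
    have : fderiv ℝ u x = 0 := by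
      by_contra h
      exact hx (support_fderiv_subset ℝ h)
    simp [gradient, this]
  have hgi : IntegrableOn (fun x => ‖gradient u x‖ ^ 2) Ω :=
    intOn_aux hΩ hc hs ((grad_cont hu).norm.pow 2).continuousOn (fun x hx => by simp [hgz x hx])
  have hli : IntegrableOn (fun x => u x ^ 2 * (dvg F x - ‖F x‖ ^ 2)) Ω :=
    intOn_aux hΩ hc hs ((hu.continuous.pow 2).continuousOn.mul
      ((dvg_cont hΩ hF).sub (hF.continuousOn.norm.pow 2))) (fun x hx => by simp [hz x hx])
  have key : ∫ x in Ω, u x ^ 2 * (dvg F x - ‖F x‖ ^ 2) ≤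
      ∫ x in Ω, (‖gradient u x‖ ^ 2 + dvg W x) := by
    refine setIntegral_mono_on hli (hgi.add hWi) hΩ.measurableSet fun x hx => ?_
    have hFd : DifferentiableAt ℝ F x :=
      (hF.contDiffAt (hΩ.mem_nhds hx)).differentiableAt one_ne_zero
    have hud : DifferentiableAt ℝ u x := hu.differentiable one_ne_zero x
    have e1 : dvg W x = 2 * u x * inner ℝ (gradient u x) (F x) + u x ^ 2 * dvg F x := by
      rw [hW, dvg_smul (hud.fun_pow 2) hFd, inner_gradient_left, fderiv_fun_pow 2 hud]
      simp
    have e2 : 0 ≤ ‖gradient u x + u x • F x‖ ^ 2 := by positivity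
    rw [norm_add_sq_real, norm_smul, inner_smul_right, mul_pow, norm_eq_abs, sq_abs] at e2
    rw [e1]; linarith
  rw [integral_add hgi hWi, hint2] at key
  simpa using key

lemma scal1 {h a r2 δ : ℝ} (hh : 0 ≤ h) (ha : 0 < a) (hr : 0 ≤ r2) (hδ : 0 < δ)
    (hrR : a * r2 ≤ 1) : h ^ 2 / (r2 + δ) + a ≤
      (h / (r2 + δ) + a) * (2 * h + 2) - 2 * h * r2 / (r2 + δ) ^ 2 - (h / (r2 + δ) + a) ^ 2 * r2 := by
  have hs : 0 < r2 + δ := by linarith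
  set σ := (r2 + δ)⁻¹ with hσ
  have hσ0 : 0 < σ := inv_pos.2 hs
  have hy : r2 * σ ≤ 1 := by
    rw [hσ, ← div_eq_mul_inv, div_le_one hs]; linarith
  have hy0 : 0 ≤ r2 * σ := by positivity
  simp only [div_eq_mul_inv, ← inv_pow, ← hσ]
  have e1 : 0 ≤ h * σ * ((2 + h) * (1 - r2 * σ)) := by
    have : 0 ≤ 1 - r2 * σ := by linarith
    positivity
  have e2 : 0 ≤ a * (2 * h * (1 - r2 * σ) + (1 - a * r2)) := by
    have : 0 ≤ 1 - r2 * σ := by linarith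
    have : 0 ≤ 1 - a * r2 := by linarith
    positivity
  nlinarith

lemma scal2 {h A r2 p q D ρ t m P M0 R2 M : ℝ} (hr : 0 ≤ r2) (hrR : r2 ≤ R2)
    (hA : 0 ≤ A * r2) (hA1 : A * r2 ≤ h + 1) (hρ : 0 < ρ) (ht : 0 < t) (htR : t * R2 ≤ 1 / 2)
    (hp : |p| ≤ P) (hq : 0 ≤ q) (hD : |D| ≤ M0) (hm : 0 < m) (hmm : m ≤ r2 * q + ρ ^ 2)
    (hM : M = 2 * P + R2 * M0 + 2 * (h + 1) * P) :
    t * (m / 4) / ρ ^ 2 - t * (1 / 2 + M ^ 2 / m) ≤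
      -(t * (2 * p / ρ - r2 * q / ρ ^ 2)) - t * r2 / ρ * D + 2 * A * (t * r2 / ρ) * p
        - (t * r2 / ρ) ^ 2 * q := by
  set w := ρ⁻¹ with hw
  have hw0 : 0 < w := inv_pos.2 hρ
  have hwρ : ρ * w = 1 := mul_inv_cancel₀ hρ.ne'
  simp only [div_eq_mul_inv, ← inv_pow, ← hw]
  have hP : 0 ≤ P := (abs_nonneg _).trans hp
  have hM0 : 0 ≤ M0 := (abs_nonneg _).trans hD
  have b1 : 2 * p ≤ 2 * P := by linarith [le_abs_self p]
  have b2 : r2 * D ≤ R2 * M0 := by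
    calc r2 * D ≤ r2 * M0 := by gcongr; exact (le_abs_self D).trans hD
      _ ≤ _ := by gcongr
  have b3 : -((h + 1) * P) ≤ (A * r2) * p := by
    have : (A * r2) * (-p) ≤ (h + 1) * P := by
      calc (A * r2) * (-p) ≤ (A * r2) * P := by gcongr; exact (neg_le_abs p).trans hp
        _ ≤ _ := by gcongr
    linarith
  have c1 : -(M * w) ≤ (-(2 * p) - r2 * D + 2 * ((A * r2) * p)) * w := by
    rw [← neg_mul]; gcongr; linarith
  have c2 : r2 * q * w ^ 2 / 2 ≤ r2 * q * w ^ 2 - t * r2 ^ 2 * q * w ^ 2 := by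
    have : t * r2 ≤ 1 / 2 := le_trans (by gcongr) htR
    have : 0 ≤ (1 / 2 - t * r2) * (r2 * q * w ^ 2) := by
      have : 0 ≤ 1 / 2 - t * r2 := by linarith
      positivity
    nlinarith
  have c3 : m * w ^ 2 - 1 ≤ r2 * q * w ^ 2 := by
    have : m * w ^ 2 ≤ (r2 * q + ρ ^ 2) * w ^ 2 := by gcongr
    have e : ρ ^ 2 * w ^ 2 = 1 := by rw [← mul_pow, hwρ, one_pow]
    nlinarith
  have c4 : M * w ≤ m * w ^ 2 / 4 + M ^ 2 * m⁻¹ := by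
    have : m * w ^ 2 / 4 + M ^ 2 * m⁻¹ - M * w = m⁻¹ * (m * w / 2 - M) ^ 2 := by
      field_simp; ring
    have : 0 ≤ m⁻¹ * (m * w / 2 - M) ^ 2 := by positivity
    linarith
  have tot : m / 4 * w ^ 2 - (1 / 2 + M ^ 2 * m⁻¹) ≤
     (-(2 * p) - r2 * D + 2 * ((A * r2) * p)) * w + (r2 * q * w ^ 2 - t * r2 ^ 2 * q * w ^ 2) := by
    linarith
  have := mul_le_mul_of_nonneg_left tot ht.le
  norm_num at this ⊢
  nlinarith

def fld {N : ℕ} (ρ : EE N → ℝ) (h a t δ : ℝ) : EE N → EE N :=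
  fun y => (h * (‖y‖ ^ 2 + δ)⁻¹ + a) • y + (-(t * ‖y‖ ^ 2 * (ρ y)⁻¹)) • gradient ρ y

lemma grad_contDiff {N : ℕ} {ρ : EE N → ℝ} (hρ : ContDiff ℝ 2 ρ) : ContDiff ℝ 1 (gradient ρ) := by
  unfold gradient
  exact (InnerProductSpace.toDual ℝ (EE N)).symm.contDiff.comp
    (hρ.fderiv_right (m := 1) (by norm_num))

lemma fld_contDiff {N : ℕ} {Ω : Set (EE N)} {ρ : EE N → ℝ} (hρ : ContDiff ℝ 2 ρ)
    (hpos : ∀ x ∈ Ω, 0 < ρ x) {h a t δ : ℝ} (hδ : 0 < δ) :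
    ContDiffOn ℝ 1 (fld ρ h a t δ) Ω := by
  unfold fld
  have hn : ContDiff ℝ 1 (fun y : EE N => ‖y‖ ^ 2) := contDiff_norm_sq ℝ
  refine ContDiffOn.add (ContDiffOn.fun_smul ?_ contDiffOn_id)
    (ContDiffOn.fun_smul ?_ (grad_contDiff hρ).contDiffOn)
  · refine ((contDiff_const.mul ((hn.add contDiff_const).inv fun x => ?_)).add
      contDiff_const).contDiffOn
    positivity
  · refine ((contDiff_const.mul hn).contDiffOn.mul
      (ContDiffOn.inv (hρ.of_le (by norm_num)).contDiffOn fun x hx => (hpos x hx).ne')).neg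

lemma fld_dvg {N : ℕ} {ρ : EE N → ℝ} (hρ : ContDiff ℝ 2 ρ) {x : EE N}
    (hpos : 0 < ρ x) {h a t δ : ℝ} (hδ : 0 < δ) :
    dvg (fld ρ h a t δ) x = (h / (‖x‖ ^ 2 + δ) + a) * N - 2 * h * ‖x‖ ^ 2 / (‖x‖ ^ 2 + δ) ^ 2
      -(t * (2 * inner ℝ x (gradient ρ x) / ρ x - ‖x‖ ^ 2 * ‖gradient ρ x‖ ^ 2 / ρ x ^ 2))
      - t * ‖x‖ ^ 2 / ρ x * dvg (gradient ρ) x := by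
  have hs : (‖x‖ ^ 2 + δ) ≠ 0 := by positivity
  have hn : HasFDerivAt (fun y : EE N => ‖y‖ ^ 2) (2 • innerSL ℝ x) x :=
    (hasStrictFDerivAt_norm_sq x).hasFDerivAt
  have hρd : HasFDerivAt ρ (fderiv ℝ ρ x) x := (hρ.differentiable two_ne_zero x).hasFDerivAt
  have hf := (((hasDerivAt_inv hs).comp_hasFDerivAt x (hn.add_const δ)).const_mul h).add_const a
  have hg := (((hn.const_mul t).mul ((hasDerivAt_inv hpos.ne').comp_hasFDerivAt x hρd))).neg
  have hG := (grad_contDiff hρ).differentiable one_ne_zero x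
  have hf' : HasFDerivAt (fun y : EE N => h * (‖y‖ ^ 2 + δ)⁻¹ + a) _ x := hf
  have hg' : HasFDerivAt (fun y : EE N => -(t * ‖y‖ ^ 2 * (ρ y)⁻¹)) _ x := hg
  unfold fld
  rw [dvg_add (hf'.differentiableAt.fun_smul differentiableAt_fun_id) (hg'.differentiableAt.fun_smul hG),
    dvg_smul hf'.differentiableAt differentiableAt_fun_id, dvg_smul hg'.differentiableAt hG,
    hf'.fderiv, hg'.fderiv]
  have e := dvg_id x

  rw [e]
  have e2 : fderiv ℝ ρ x (gradient ρ x) = ‖gradient ρ x‖ ^ 2 := by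
    rw [← inner_gradient_left, real_inner_self_eq_norm_sq]
  simp [e2, real_inner_self_eq_norm_sq]
  field_simp
  ring

lemma fld_norm {N : ℕ} (ρ : EE N → ℝ) (x : EE N) (h a t δ : ℝ) :
    ‖fld ρ h a t δ x‖ ^ 2 = (h / (‖x‖ ^ 2 + δ) + a) ^ 2 * ‖x‖ ^ 2
      - 2 * (h / (‖x‖ ^ 2 + δ) + a) * (t * ‖x‖ ^ 2 / ρ x) * inner ℝ x (gradient ρ x)
      + (t * ‖x‖ ^ 2 / ρ x) ^ 2 * ‖gradient ρ x‖ ^ 2 := by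
  unfold fld
  rw [norm_add_sq_real, norm_smul, norm_smul, inner_smul_left, inner_smul_right, mul_pow, mul_pow,
    norm_eq_abs, norm_eq_abs, sq_abs, sq_abs]
  simp only [div_eq_mul_inv, conj_trivial]
  ring

lemma frontier_ne {N : ℕ} (hN : 3 ≤ N) {Ω : Set (EE N)} (hΩb : Bornology.IsBounded Ω)
    (h0 : (0 : EE N) ∈ Ω) : (frontier Ω).Nonempty := by
  rw [nonempty_frontier_iff]
  refine ⟨⟨0, h0⟩, ?_⟩
  rintro rfl
  have : Nonempty (Fin N) := ⟨⟨0, by omega⟩⟩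
  exact NormedSpace.unbounded_univ ℝ (EE N) hΩb

lemma bdist_pos {N : ℕ} (hN : 3 ≤ N) {Ω : Set (EE N)} (hΩo : IsOpen Ω)
    (hΩb : Bornology.IsBounded Ω) (h0 : (0 : EE N) ∈ Ω) {x : EE N} (hx : x ∈ Ω) :
    0 < bdist Ω x := by
  unfold bdist
  rw [← isClosed_frontier.notMem_iff_infDist_pos (frontier_ne hN hΩb h0)]
  intro h
  rw [hΩo.frontier_eq] at h
  exact h.2 hx

lemma field_exists (N : ℕ) (hN : 3 ≤ N) (Ω : Set (EE N)) (hΩo : IsOpen Ω)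
    (hΩb : Bornology.IsBounded Ω) (hΩsm : IsC2Domain Ω) (h0 : (0 : EE N) ∈ Ω) :
    ∃ c : ℝ, 0 < c ∧ ∀ δ : ℝ, 0 < δ → ∃ F : EE N → EE N, ContDiffOn ℝ 1 F Ω ∧
      ∀ x ∈ Ω, (((N : ℝ) - 2) / 2) ^ 2 / (‖x‖ ^ 2 + δ) + c / bdist Ω x ^ 2 ≤
        dvg F x - ‖F x‖ ^ 2 := by
  obtain ⟨φ, hφ, hΩφ, hφd⟩ := hΩsm
  set ρ : EE N → ℝ := fun x => - φ x with hρdef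
  have hρ : ContDiff ℝ 2 ρ := hφ.neg
  have hpos : ∀ x ∈ Ω, 0 < ρ x := by
    intro x hx
    rw [hΩφ] at hx
    have : φ x < 0 := hx
    simp only [hρdef]; linarith
  have hG := grad_contDiff hρ
  have hgnorm : ∀ x, ‖gradient ρ x‖ = ‖fderiv ℝ ρ x‖ := by
    intro x; simp [gradient]
  have hfr : ∀ x ∈ frontier Ω, ρ x = 0 := by
    intro x hx
    rw [hΩo.frontier_eq] at hx
    have h1 : φ x ≤ 0 := by
      have : closure Ω ⊆ {x | φ x ≤ 0} := by
        refine closure_minimal ?_ (isClosed_le hφ.continuous continuous_const)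
        rw [hΩφ]; intro y hy; exact le_of_lt (show φ y < 0 from hy)
      exact this hx.1
    have h2 : ¬ φ x < 0 := fun h => hx.2 (by rw [hΩφ]; exact h)
    simp only [hρdef]; linarith
  have hgr : ∀ x ∈ frontier Ω, 0 < ‖gradient ρ x‖ := by
    intro x hx
    rw [hgnorm, norm_pos_iff]
    have := hφd x hx
    simpa [hρdef, fderiv_fun_neg] using this
  obtain ⟨R0, hR0⟩ := hΩb.subset_closedBall (0 : EE N)
  set R := max R0 1 with hR
  have hR1 : 1 ≤ R := le_max_right _ _
  have hΩR : Ω ⊆ Metric.closedBall 0 R := hR0.trans (Metric.closedBall_subset_closedBall (le_max_left _ _))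
  have hclR : closure Ω ⊆ Metric.closedBall 0 R := closure_minimal hΩR Metric.isClosed_closedBall
  have hK : IsCompact (Metric.closedBall (0 : EE N) R) := isCompact_closedBall _ _
  obtain ⟨L0, hL0⟩ := hK.exists_bound_of_continuousOn hG.continuous.continuousOn
  obtain ⟨M0, hM0⟩ := hK.exists_bound_of_continuousOn
    ((dvg_cont isOpen_univ hG.contDiffOn).mono (Set.subset_univ _))
  set L := max L0 1 with hL
  have hL1 : 1 ≤ L := le_max_right _ _
  have hLb : ∀ x ∈ Metric.closedBall (0 : EE N) R, ‖gradient ρ x‖ ≤ L :=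
    fun x hx => (hL0 x hx).trans (le_max_left _ _)
  -- the distance estimate
  have hdist : ∀ x ∈ Ω, ρ x ≤ L * bdist Ω x := by
    intro x hx
    obtain ⟨y, hy, hxy⟩ := isClosed_frontier.exists_infDist_eq_dist (frontier_ne hN hΩb h0) x
    have hyR := hclR (frontier_subset_closure hy)
    have := (convex_closedBall (0 : EE N) R).norm_image_sub_le_of_norm_fderiv_le (𝕜 := ℝ) (f := ρ)
      (C := L) (fun z _ => hρ.differentiable two_ne_zero z)
      (fun z hz => by rw [← hgnorm]; exact hLb z hz) hyR (hΩR hx)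
    rw [hfr y hy, sub_zero] at this
    unfold bdist
    rw [hxy, dist_eq_norm]
    exact (le_abs_self _).trans this
  -- lower bound
  have hcl : IsCompact (closure Ω) := hK.of_isClosed_subset isClosed_closure hclR
  obtain ⟨z, hz, hzmin⟩ := hcl.exists_isMinOn ⟨0, subset_closure h0⟩
    (f := fun x => ‖x‖ ^ 2 * ‖gradient ρ x‖ ^ 2 + ρ x ^ 2)
    (((continuous_norm.pow 2).mul (hG.continuous.norm.pow 2)).add
      (hρ.continuous.pow 2)).continuousOn
  set m := ‖z‖ ^ 2 * ‖gradient ρ z‖ ^ 2 + ρ z ^ 2 with hm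
  have hmpos : 0 < m := by
    by_cases hzΩ : z ∈ Ω
    · have := hpos z hzΩ
      positivity
    · have hzf : z ∈ frontier Ω := by rw [hΩo.frontier_eq]; exact ⟨hz, hzΩ⟩
      have h1 := hgr z hzf
      have h2 : 0 < ‖z‖ := by
        rw [norm_pos_iff]; rintro rfl; exact hzΩ h0
      positivity
  have hmle : ∀ x ∈ Ω, m ≤ ‖x‖ ^ 2 * ‖gradient ρ x‖ ^ 2 + ρ x ^ 2 :=
    fun x hx => hzmin (subset_closure hx)
  set h : ℝ := ((N : ℝ) - 2) / 2 with hh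
  have hN' : (3 : ℝ) ≤ N := by exact_mod_cast hN
  have hh0 : 0 ≤ h := by rw [hh]; linarith
  have hNh : (N : ℝ) = 2 * h + 2 := by rw [hh]; ring
  set P := R * L with hP
  set M := 2 * P + R ^ 2 * M0 + 2 * (h + 1) * P with hM
  set C0 := 1 / 2 + M ^ 2 / m with hC0
  have hC0pos : 0 < C0 := by positivity
  set a := 1 / R ^ 2 with ha
  have hapos : 0 < a := by positivity
  set t := min (1 / (2 * R ^ 2)) (a / C0) with ht
  have htpos : 0 < t := by rw [ht]; positivity
  have htR : t * R ^ 2 ≤ 1 / 2 := by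
    calc t * R ^ 2 ≤ 1 / (2 * R ^ 2) * R ^ 2 := by gcongr; exact min_le_left _ _
      _ = 1 / 2 := by field_simp
  have htC : t * C0 ≤ a := by
    calc t * C0 ≤ a / C0 * C0 := by gcongr; exact min_le_right _ _
      _ = a := by field_simp
  refine ⟨t * (m / 4) / L ^ 2, by positivity, fun δ hδ => ⟨fld ρ h a t δ,
    fld_contDiff hρ hpos hδ, fun x hx => ?_⟩⟩
  have hxR := hΩR hx
  have hxn : ‖x‖ ≤ R := by simpa using hxR
  have hr2 : ‖x‖ ^ 2 ≤ R ^ 2 := by gcongr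
  have har : a * ‖x‖ ^ 2 ≤ 1 := by
    calc a * ‖x‖ ^ 2 ≤ a * R ^ 2 := by gcongr
      _ = 1 := by rw [ha]; field_simp
  have s1 := scal1 (h := h) (a := a) (r2 := ‖x‖ ^ 2) (δ := δ) hh0 hapos (by positivity) hδ har
  have hA1 : (h / (‖x‖ ^ 2 + δ) + a) * ‖x‖ ^ 2 ≤ h + 1 := by
    have : ‖x‖ ^ 2 / (‖x‖ ^ 2 + δ) ≤ 1 := by
      rw [div_le_one (by positivity)]; linarith
    have e : (h / (‖x‖ ^ 2 + δ) + a) * ‖x‖ ^ 2 = h * (‖x‖ ^ 2 / (‖x‖ ^ 2 + δ)) + a * ‖x‖ ^ 2 := by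
      ring
    rw [e]
    nlinarith
  have hpP : |inner ℝ x (gradient ρ x)| ≤ P := by
    refine (abs_real_inner_le_norm _ _).trans ?_
    rw [hP]
    gcongr
    exact hLb x hxR
  have s2 := scal2 (h := h) (A := h / (‖x‖ ^ 2 + δ) + a) (r2 := ‖x‖ ^ 2)
    (p := inner ℝ x (gradient ρ x)) (q := ‖gradient ρ x‖ ^ 2) (D := dvg (gradient ρ) x)
    (ρ := ρ x) (t := t) (m := m) (P := P) (M0 := M0) (R2 := R ^ 2) (M := M)
    (by positivity) hr2 (by positivity) hA1 (hpos x hx) htpos htR hpP (by positivity)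
    (hM0 x hxR) hmpos (hmle x hx) hM
  rw [← hC0] at s2
  rw [fld_dvg hρ (hpos x hx) hδ, fld_norm, hNh]
  have hb := bdist_pos hN hΩo hΩb h0 hx
  have s3 : t * (m / 4) / L ^ 2 / bdist Ω x ^ 2 ≤ t * (m / 4) / ρ x ^ 2 := by
    rw [div_div, ← mul_pow]
    have := hpos x hx
    gcongr
    exact hdist x hx
  linarith

lemma hardy_main (N : ℕ) (hN : 3 ≤ N) (Ω : Set (EE N)) (hΩo : IsOpen Ω)
    (hΩb : Bornology.IsBounded Ω) (h0 : (0 : EE N) ∈ Ω) (c : ℝ) (hc0 : 0 < c)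
    (hF : ∀ δ : ℝ, 0 < δ → ∃ F : EE N → EE N, ContDiffOn ℝ 1 F Ω ∧
      ∀ x ∈ Ω, (((N : ℝ) - 2) / 2) ^ 2 / (‖x‖ ^ 2 + δ) + c / bdist Ω x ^ 2 ≤
        dvg F x - ‖F x‖ ^ 2) (u : EE N → ℝ) (hu : ContDiff ℝ 1 u) (hc : HasCompactSupport u)
    (hs : tsupport u ⊆ Ω) :
    IntegrableOn (fun x => u x ^ 2 * (c / bdist Ω x ^ 2)) Ω ∧
    ∫ x in Ω, u x ^ 2 * (c / bdist Ω x ^ 2) ≤ ∫ x in Ω, (‖gradient u x‖ ^ 2 -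
              ((N : ℝ) - 2) ^ 2 / (4 * ‖x‖ ^ 2) * u x ^ 2) := by
  have hz : ∀ x, x ∉ tsupport u → u x = 0 := fun x hx => image_eq_zero_of_notMem_tsupport hx
  have hu2 : ContinuousOn (fun x => u x ^ 2) Ω := (hu.continuous.pow 2).continuousOn
  have hi1 : IntegrableOn (fun x => u x ^ 2 * (c / bdist Ω x ^ 2)) Ω := by
    refine intOn_aux hΩo hc hs (hu2.mul (continuousOn_const.div
      ((Metric.continuous_infDist_pt _).pow 2).continuousOn fun x hx => ?_))
      (fun x hx => by simp [hz x hx])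
    have := bdist_pos hN hΩo hΩb h0 hx
    unfold bdist at this
    positivity
  refine ⟨hi1, ?_⟩
  have hgz : ∀ x, x ∉ tsupport u → gradient u x = 0 := by
    intro x hx
    have : fderiv ℝ u x = 0 := by
      by_contra h
      exact hx (support_fderiv_subset ℝ h)
    simp [gradient, this]
  have hgi : IntegrableOn (fun x => ‖gradient u x‖ ^ 2) Ω :=
    intOn_aux hΩo hc hs ((grad_cont hu).norm.pow 2).continuousOn (fun x hx => by simp [hgz x hx])
  set H : ℝ := (((N : ℝ) - 2) / 2) ^ 2 with hH
  have hH0 : 0 ≤ H := by positivity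
  set g : ℕ → EE N → ℝ := fun n x => u x ^ 2 * (H / (‖x‖ ^ 2 + 1 / ((n : ℝ) + 1))) with hg
  have hg0 : ∀ n x, 0 ≤ g n x := fun n x => by simp only [hg]; positivity
  have hgint : ∀ n, IntegrableOn (g n) Ω := by
    intro n
    refine intOn_aux hΩo hc hs (hu2.mul (continuousOn_const.div
      ((continuous_norm.pow 2).add continuous_const).continuousOn fun x hx => ?_))
      (fun x hx => by simp [hg, hz x hx])
    positivity
  have hgle : ∀ n, ∫ x in Ω, g n x ≤
      (∫ x in Ω, ‖gradient u x‖ ^ 2) - ∫ x in Ω, u x ^ 2 * (c / bdist Ω x ^ 2) := by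
    intro n
    have hδ : 0 < 1 / ((n : ℝ) + 1) := by positivity
    obtain ⟨F, hFc, hFle⟩ := hF _ hδ
    have k1 := vf_ineq hΩo hu hc hs hFc
    have k2 : ∫ x in Ω, (g n x + u x ^ 2 * (c / bdist Ω x ^ 2)) ≤
        ∫ x in Ω, u x ^ 2 * (dvg F x - ‖F x‖ ^ 2) := by
      refine setIntegral_mono_on ((hgint n).add hi1) ?_ hΩo.measurableSet fun x hx => ?_
      · exact intOn_aux hΩo hc hs (hu2.mul
          ((dvg_cont hΩo hFc).sub (hFc.continuousOn.norm.pow 2))) (fun x hx => by simp [hz x hx])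
      · simp only [hg]
        rw [← mul_add]
        exact mul_le_mul_of_nonneg_left (hFle x hx) (by positivity)
    rw [integral_add (hgint n) hi1] at k2
    linarith
  set B : ℝ := (∫ x in Ω, ‖gradient u x‖ ^ 2) - ∫ x in Ω, u x ^ 2 * (c / bdist Ω x ^ 2) with hB
  set G : EE N → ℝ := fun x => ((N : ℝ) - 2) ^ 2 / (4 * ‖x‖ ^ 2) * u x ^ 2 with hGdef
  have : Nonempty (Fin N) := ⟨⟨0, by omega⟩⟩
  have hlim : ∀ᵐ x ∂(volume.restrict Ω), Filter.Tendsto (fun n => g n x) Filter.atTop (nhds (G x)) := by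
    refine ae_restrict_of_ae ?_
    filter_upwards [Measure.ae_ne volume (0 : EE N)] with x hx
    have hx0 : 0 < ‖x‖ := norm_pos_iff.2 hx
    have e : G x = u x ^ 2 * (H / (‖x‖ ^ 2 + 0)) := by
      simp only [hGdef, hH]
      field_simp
      ring
    rw [e]
    refine Filter.Tendsto.const_mul _ (Filter.Tendsto.div tendsto_const_nhds
      (tendsto_const_nhds.add tendsto_one_div_add_atTop_nhds_zero_nat) (by positivity))
  have hGi : IntegrableOn G Ω := by
    refine ⟨aestronglyMeasurable_of_tendsto_ae _ (fun n => (hgint n).aestronglyMeasurable) hlim, ?_⟩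
    have k1 : ∫⁻ x in Ω, ‖G x‖ₑ ≤ Filter.liminf (fun n => ∫⁻ x in Ω, ‖g n x‖ₑ) Filter.atTop := by
      rw [lintegral_congr_ae (g := fun x => Filter.liminf (fun n => ‖g n x‖ₑ) Filter.atTop)
        (by filter_upwards [hlim] with x hx using hx.enorm.liminf_eq.symm)]
      exact lintegral_liminf_le' fun n => (hgint n).aestronglyMeasurable.enorm
    have k2 : Filter.liminf (fun n => ∫⁻ x in Ω, ‖g n x‖ₑ) Filter.atTop ≤ ENNReal.ofReal B := by
      refine Filter.liminf_le_of_frequently_le' (Filter.Frequently.of_forall fun n => ?_)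
      rw [← ofReal_integral_norm_eq_lintegral_enorm (hgint n)]
      refine ENNReal.ofReal_le_ofReal ?_
      simpa only [norm_eq_abs, abs_of_nonneg (hg0 n _)] using hgle n
    exact (k1.trans k2).trans_lt ENNReal.ofReal_lt_top
  have hGB : ∫ x in Ω, G x ≤ B := by
    refine le_of_tendsto' (integral_tendsto_of_tendsto_of_monotone hgint hGi ?_ hlim) hgle
    refine Filter.Eventually.of_forall fun x n k hnk => ?_
    simp only [hg]
    gcongr
  rw [integral_sub hgi hGi]
  linarith

lemma log_bound {c ε d : ℝ} (hc : 0 < c) (hε : 0 < ε) (hd : 0 < d) :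
    -Real.log d ≤ ε * (c / d ^ 2) + (-(1 / 2) * Real.log (2 * c) - 1 / 2 * Real.log ε) := by
  have h := Real.log_le_sub_one_of_pos (show 0 < 2 * c * ε / d ^ 2 by positivity)
  rw [Real.log_div (by positivity) (by positivity), Real.log_mul (by positivity) hε.ne',
    Real.log_pow] at h
  have e : 2 * c * ε / d ^ 2 = 2 * (ε * (c / d ^ 2)) := by ring
  rw [e] at h
  push_cast at h
  linarith

/-- Logarithmic Hardy–Sobolev inequality with entropy weight `-log d(x)`. -/
theorem log_hardy_sobolev_boundary_weight
    (N : ℕ) (hN : 3 ≤ N)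
    (Ω : Set (EuclideanSpace ℝ (Fin N))) (hΩo : IsOpen Ω) (hΩconn : IsConnected Ω)
    (hΩb : Bornology.IsBounded Ω) (hΩsm : IsC2Domain Ω)
    (h0 : (0 : EuclideanSpace ℝ (Fin N)) ∈ Ω) :
    ∃ K₁ : ℝ, 0 < K₁ ∧
      ∀ u : EuclideanSpace ℝ (Fin N) → ℝ,
        ContDiff ℝ (⊤ : ℕ∞) u → HasCompactSupport u → tsupport u ⊆ Ω → (∀ x, 0 ≤ u x) →
        ∀ ε : ℝ, 0 < ε →
        (∫ x in Ω, u x ^ 2 * (-Real.log (bdist Ω x))) ≤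
          ε * (∫ x in Ω, (‖gradient u x‖ ^ 2 -
              ((N : ℝ) - 2) ^ 2 / (4 * ‖x‖ ^ 2) * u x ^ 2)) +
            (K₁ - (1 / 2) * Real.log ε) * ∫ x in Ω, u x ^ 2 := by
  obtain ⟨c, hc0, hF⟩ := field_exists N hN Ω hΩo hΩb hΩsm h0
  refine ⟨max 1 (-(1 / 2) * Real.log (2 * c)), by positivity, ?_⟩
  intro u hu hc hs _ ε hε
  have hu1 : ContDiff ℝ 1 u := hu.of_le (by exact_mod_cast le_top)
  obtain ⟨hi1, hle⟩ := hardy_main N hN Ω hΩo hΩb h0 c hc0 hF u hu1 hc hs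
  have hz : ∀ x, x ∉ tsupport u → u x = 0 := fun x hx => image_eq_zero_of_notMem_tsupport hx
  have hu2 : ContinuousOn (fun x => u x ^ 2) Ω := (hu.continuous.pow 2).continuousOn
  have hiu : IntegrableOn (fun x => u x ^ 2) Ω :=
    intOn_aux hΩo hc hs hu2 (fun x hx => by simp [hz x hx])
  have hil : IntegrableOn (fun x => u x ^ 2 * (-Real.log (bdist Ω x))) Ω := by
    refine intOn_aux hΩo hc hs (hu2.mul (ContinuousOn.neg (ContinuousOn.log
      (Metric.continuous_infDist_pt _).continuousOn fun x hx => ?_)))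
      (fun x hx => by simp [hz x hx])
    exact (bdist_pos hN hΩo hΩb h0 hx).ne'
  set K := max 1 (-(1 / 2) * Real.log (2 * c)) with hK
  have key : (∫ x in Ω, u x ^ 2 * (-Real.log (bdist Ω x))) ≤
      ∫ x in Ω, (ε * (u x ^ 2 * (c / bdist Ω x ^ 2)) + (K - (1 / 2) * Real.log ε) * u x ^ 2) := by
    refine setIntegral_mono_on hil ((hi1.const_mul ε).add (hiu.const_mul _)) hΩo.measurableSet
      fun x hx => ?_
    have h1 := log_bound hc0 hε (bdist_pos hN hΩo hΩb h0 hx)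
    have h2 : -(1 / 2) * Real.log (2 * c) ≤ K := le_max_right _ _
    have h3 : -Real.log (bdist Ω x) ≤
        ε * (c / bdist Ω x ^ 2) + (K - 1 / 2 * Real.log ε) := by linarith
    have := mul_le_mul_of_nonneg_left h3 (sq_nonneg (u x))
    linarith
  rw [integral_add (hi1.const_mul ε) (hiu.const_mul _), integral_const_mul,
    integral_const_mul] at key
  have := mul_le_mul_of_nonneg_left hle hε.le
  linarith
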